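/- Let h ≥ 3, n ≥ 1, N ≥ 1 and d ≥ 2N + hn − 1 be integers. Let p_1, …, p_N ∈ ℂ³, p_i = (x_i, y_i, z_i), be points with (x_i, y_i) ≠ (0,0) for all i and with the classes [x_i : y_i] ∈ P¹ pairwise distinct. Then the ℂ-subspace {f ∈ V^{(h)}_{d,n} : f is singular at p_1, …, p_N} has dimension (h+1)(d+1) − n·h(h+1)/2 − 3N; that is, being singular at the N points imposes exactly 3N independent linear conditions on the space of sections of O(hE_n + dF_n). -/

import Mathlib

open MvPolynomial

noncomputable section

/-- The weights on the variables `x, y, z`: `deg x = deg y = 1`, `deg z = n`. -/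
def wt (n : ℕ) : Fin 3 → ℕ := ![1, 1, n]

/-- The subspace of `ℂ[x,y,z]` of polynomials whose degree in `z` is at most `h`. -/
def degZle (h : ℕ) : Submodule ℂ (MvPolynomial (Fin 3) ℂ) where
  carrier := {f | f.degreeOf 2 ≤ h}
  zero_mem' := by simp [Set.mem_setOf_eq, degreeOf_zero]
  add_mem' := by
    intro f g hf hg
    exact le_trans (degreeOf_add_le _ _ _) (max_le hf hg)
  smul_mem' := by
    intro c f hf
    rw [Set.mem_setOf_eq, smul_eq_C_mul]
    exact le_trans (degreeOf_C_mul_le _ _ _) hf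

/-- `V^{(h)}_{d,n}`: the space of polynomials in `ℂ[x,y,z]` that are weighted homogeneous of
degree `d` for the weights `deg x = deg y = 1`, `deg z = n`, and have degree at most `h` in `z`.
This is the space of global sections of `O(hEₙ + dFₙ)` on the Hirzebruch surface `𝔽ₙ`. -/
def Vh (h d n : ℕ) : Submodule ℂ (MvPolynomial (Fin 3) ℂ) :=
  weightedHomogeneousSubmodule ℂ (wt n) d ⊓ degZle h

/-- `V_{d,n}`, the space of global sections of `O(3Eₙ + dFₙ)` on `𝔽ₙ`. -/
def V (d n : ℕ) : Submodule ℂ (MvPolynomial (Fin 3) ℂ) := Vh 3 d n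

/-- `f` is singular at the point `p`: all partial derivatives of `f` vanish at `p`. -/
def SingularAt {σ : Type*} (f : MvPolynomial σ ℂ) (p : σ → ℂ) : Prop :=
  ∀ i, eval p (pderiv i f) = 0

/-- The subspace of polynomials singular at every point of the family `p`. -/
def singSub {ι σ : Type*} (p : ι → σ → ℂ) : Submodule ℂ (MvPolynomial σ ℂ) where
  carrier := {f | ∀ j, SingularAt f (p j)}
  zero_mem' := by intro j i; simp
  add_mem' := by
    intro f g hf hg j i
    simp [map_add, hf j i, hg j i]
  smul_mem' := by
    intro c f hf j i
    simp [smul_eq_C_mul, pderiv_C_mul, hf j i]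

/-- The exponents of the monomials spanning `Vh h d n`. -/
def expSet (h d n : ℕ) : Set (Fin 3 →₀ ℕ) :=
  {m | m 0 + m 1 + n * m 2 = d ∧ m 2 ≤ h}

lemma weight_wt (n : ℕ) (m : Fin 3 →₀ ℕ) :
    Finsupp.weight (wt n) m = m 0 + m 1 + n * m 2 := by
  simp [Finsupp.weight_eq_sum, Fin.sum_univ_three, wt, mul_comm]

lemma Vh_eq_restrictSupport (h d n : ℕ) : Vh h d n = restrictSupport ℂ (expSet h d n) := by
  ext f
  have hz : f ∈ degZle h ↔ ∀ m ∈ f.support, m 2 ≤ h := degreeOf_le_iff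
  rw [Vh, Submodule.mem_inf, hz, mem_weightedHomogeneousSubmodule, mem_restrictSupport_iff]
  simp only [IsWeightedHomogeneous, weight_wt, expSet, Set.subset_def, Finset.mem_coe,
    mem_support_iff, Set.mem_ofPred_eq]
  exact ⟨fun H m hm => ⟨H.1 hm, H.2 m hm⟩,
    fun H => ⟨fun m hm => (H m hm).1, fun m hm => (H m hm).2⟩⟩

/-- The monomial exponent with `z`-degree `k` and `x`-degree `i` of weighted degree `d`. -/
def expOf (d n : ℕ) (s : (_ : ℕ) × ℕ) : Fin 3 →₀ ℕ :=
  Finsupp.equivFunOnFinite.symm ![s.2, d - n * s.1 - s.2, s.1]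

lemma expSet_eq_image (h d n : ℕ) (hd : n * h ≤ d) :
    expSet h d n = (((Finset.range (h + 1)).sigma
      fun k => Finset.range (d - n * k + 1)).image (expOf d n) : Finset (Fin 3 →₀ ℕ)) := by
  ext m
  simp only [expSet, Set.mem_ofPred_eq, Finset.coe_image, Set.mem_image, Finset.mem_coe,
    Finset.mem_sigma, Finset.mem_range]
  constructor
  · rintro ⟨h1, h2⟩
    refine ⟨⟨m 2, m 0⟩, ⟨by lia, by dsimp only; lia⟩, ?_⟩
    ext i
    fin_cases i
    · simp [expOf]
    · simp [expOf]; lia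
    · simp [expOf]
  · rintro ⟨⟨k, i⟩, ⟨h1, h2⟩, rfl⟩
    dsimp only at h1 h2
    have : n * k ≤ n * h := Nat.mul_le_mul_left _ (by lia)
    simp [expOf]
    lia

lemma expOf_injective (d n : ℕ) : Function.Injective (expOf d n) := by
  rintro ⟨k, i⟩ ⟨k', i'⟩ H
  have h0 := DFunLike.congr_fun H 0
  have h2 := DFunLike.congr_fun H 2
  simp [expOf] at h0 h2
  simp [h0, h2]

lemma sum_sub_mul_add_one (h d n : ℕ) (hd : n * h ≤ d) :
    ∑ k ∈ Finset.range (h + 1), (d - n * k + 1) + n * (h * (h + 1) / 2) = (h + 1) * (d + 1) := by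
  have hs : h * (h + 1) / 2 = ∑ k ∈ Finset.range (h + 1), k := by
    rw [Finset.sum_range_id, mul_comm]; simp
  rw [hs, Finset.mul_sum, ← Finset.sum_add_distrib]
  rw [Finset.sum_congr rfl (g := fun _ => d + 1)]
  · simp
  · intro k hk
    have : n * k ≤ n * h := Nat.mul_le_mul_left _ (by simp at hk; lia)
    lia

lemma finite_expSet (h d n : ℕ) (hd : n * h ≤ d) : (expSet h d n).Finite := by
  rw [expSet_eq_image h d n hd]
  exact Finset.finite_toSet _

lemma finiteDimensional_Vh (h d n : ℕ) (hd : n * h ≤ d) : FiniteDimensional ℂ (Vh h d n) := by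
  rw [Vh_eq_restrictSupport]
  have := (finite_expSet h d n hd).to_subtype
  exact Module.Finite.of_basis (basisRestrictSupport ℂ (expSet h d n))

lemma finrank_Vh (h d n : ℕ) (hd : n * h ≤ d) :
    Module.finrank ℂ (Vh h d n) + n * (h * (h + 1) / 2) = (h + 1) * (d + 1) := by
  rw [Vh_eq_restrictSupport,
    Module.finrank_eq_nat_card_basis (basisRestrictSupport ℂ (expSet h d n)),
    Nat.card_coe_set_eq, expSet_eq_image h d n hd, Set.ncard_coe_finset,
    Finset.card_image_of_injective _ (expOf_injective d n), Finset.card_sigma]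
  simpa using sum_sub_mul_add_one h d n hd

/-- The linear map sending `f` to its gradients at the points of the family `p`. -/
def gradMap {ι σ : Type*} (p : ι → σ → ℂ) : MvPolynomial σ ℂ →ₗ[ℂ] ι → σ → ℂ where
  toFun f j i := eval (p j) (pderiv i f)
  map_add' f g := by ext; simp
  map_smul' c f := by ext; simp [smul_eq_C_mul]

@[simp]
lemma gradMap_apply {ι σ : Type*} (p : ι → σ → ℂ) (f : MvPolynomial σ ℂ) (j : ι) (i : σ) :
    gradMap p f j i = eval (p j) (pderiv i f) := rfl

lemma ker_gradMap {ι σ : Type*} (p : ι → σ → ℂ) : LinearMap.ker (gradMap p) = singSub p := by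
  ext f
  simp only [LinearMap.mem_ker, funext_iff, gradMap_apply, Pi.zero_apply]
  rfl

lemma singularAt_of_sq_dvd {σ : Type*} {f l : MvPolynomial σ ℂ} {p : σ → ℂ} (hl : eval p l = 0)
    (h : l ^ 2 ∣ f) : SingularAt f p := by
  obtain ⟨g, rfl⟩ := h
  intro i
  simp [Derivation.leibniz_pow, hl]

/-- The equation of the line of the ruling through `q`. -/
def fiberEq (q : Fin 3 → ℂ) : MvPolynomial (Fin 3) ℂ := C (q 1) * X 0 - C (q 0) * X 1

@[simp]
lemma eval_fiberEq (p q : Fin 3 → ℂ) : eval p (fiberEq q) = q 1 * p 0 - q 0 * p 1 := by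
  simp [fiberEq]

lemma isWeightedHomogeneous_fiberEq (n : ℕ) (q : Fin 3 → ℂ) :
    (fiberEq q).IsWeightedHomogeneous (wt n) 1 := by
  have h0 := (isWeightedHomogeneous_X ℂ (wt n) 0).C_mul (q 1)
  have h1 := (isWeightedHomogeneous_X ℂ (wt n) 1).C_mul (q 0)
  exact (weightedHomogeneousSubmodule ℂ (wt n) 1).sub_mem h0 h1

lemma degreeOf_two_fiberEq (q : Fin 3 → ℂ) : (fiberEq q).degreeOf 2 = 0 := by
  have h0 : (C (q 1) * X 0 : MvPolynomial (Fin 3) ℂ).degreeOf 2 ≤ 0 :=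
    (degreeOf_C_mul_le _ _ _).trans (degreeOf_X_of_ne (by decide)).le
  have h1 : (C (q 0) * X 1 : MvPolynomial (Fin 3) ℂ).degreeOf 2 ≤ 0 :=
    (degreeOf_C_mul_le _ _ _).trans (degreeOf_X_of_ne (by decide)).le
  exact Nat.le_zero.mp ((degreeOf_sub_le _ _ _).trans (max_le h0 h1))

lemma pderiv_eq_zero_of_degreeOf_eq_zero {σ R : Type*} [CommSemiring R] {i : σ}
    {f : MvPolynomial σ R} (h : f.degreeOf i = 0) : pderiv i f = 0 := by
  classical
  refine pderiv_eq_zero_of_notMem_vars fun hi => ?_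
  rw [vars_def, Multiset.mem_toFinset, ← Multiset.count_pos, ← degreeOf_def, h] at hi
  exact hi.false

/-- A form in `x, y` singular at all points of `p` but the `j`-th, where it does not vanish. -/
lemma exists_separating_form (n N : ℕ) (p : Fin N → Fin 3 → ℂ)
    (hdist : ∀ j j', j ≠ j' → p j 0 * p j' 1 ≠ p j' 0 * p j 1) (j : Fin N) :
    ∃ Q : MvPolynomial (Fin 3) ℂ, Q.IsWeightedHomogeneous (wt n) (2 * (N - 1)) ∧
      Q.degreeOf 2 = 0 ∧ eval (p j) Q ≠ 0 ∧ ∀ i ≠ j, fiberEq (p i) ^ 2 ∣ Q := by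
  refine ⟨∏ i ∈ Finset.univ.erase j, fiberEq (p i) ^ 2, ?_, ?_, ?_, ?_⟩
  · have := IsWeightedHomogeneous.prod (Finset.univ.erase j) (fun i => fiberEq (p i) ^ 2)
      (fun _ => 2 • 1) fun i _ => (isWeightedHomogeneous_fiberEq n (p i)).pow 2
    simpa [mul_comm] using this
  · refine Nat.le_zero.mp ((degreeOf_prod_le _ _ _).trans (Finset.sum_nonpos fun i _ => ?_))
    exact (degreeOf_pow_le _ _ _).trans (by simp [degreeOf_two_fiberEq])
  · rw [map_prod, Finset.prod_ne_zero_iff]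
    intro i hi
    have := hdist j i (Finset.ne_of_mem_erase hi).symm
    rw [map_pow, eval_fiberEq]
    refine pow_ne_zero _ fun h0 => this ?_
    linear_combination h0
  · intro i hi
    exact Finset.dvd_prod_of_mem (fun i => fiberEq (p i) ^ 2) (by simp [hi])

/-- A submodule of `ℂ³` containing the normal `(y, -x, 0)` to `(x, y)`, a horizontal vector not
orthogonal to `(x, y)`, and a non-horizontal vector is everything. -/
lemma eq_top_of_three_vectors {W : Submodule ℂ (Fin 3 → ℂ)} {x y : ℂ} (hxy : (x, y) ≠ (0, 0))
    {u v w : Fin 3 → ℂ} (hu : u ∈ W) (hv : v ∈ W) (hw : w ∈ W) {c : ℂ} (hc : c ≠ 0)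
    (hu0 : u 0 = c * y) (hu1 : u 1 = -(c * x)) (hu2 : u 2 = 0)
    (hv1 : x * v 0 + y * v 1 ≠ 0) (hv2 : v 2 = 0) (hw2 : w 2 ≠ 0) : W = ⊤ := by
  rw [eq_top_iff]
  rintro t -
  obtain ⟨γ, hγ⟩ : ∃ γ, γ * w 2 = t 2 := ⟨t 2 / w 2, by field_simp⟩
  obtain ⟨β, hβ⟩ : ∃ β, β * (x * v 0 + y * v 1) =
      x * (t 0 - γ * w 0) + y * (t 1 - γ * w 1) := ⟨_, div_mul_cancel₀ _ hv1⟩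
  obtain ⟨α, h0, h1⟩ : ∃ α, α * (c * y) = t 0 - γ * w 0 - β * v 0 ∧
      α * (c * x) = -(t 1 - γ * w 1 - β * v 1) := by
    by_cases hx : x = 0
    · have hy : y ≠ 0 := fun hy => hxy (by rw [hx, hy])
      refine ⟨(t 0 - γ * w 0 - β * v 0) / (c * y), by field_simp, ?_⟩
      subst hx
      have : y * (t 1 - γ * w 1 - β * v 1) = 0 := by linear_combination -hβ
      simp [(mul_eq_zero.mp this).resolve_left hy]
    · refine ⟨-(t 1 - γ * w 1 - β * v 1) / (c * x), ?_, by field_simp⟩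
      field_simp
      linear_combination hβ
  have : t = α • u + β • v + γ • w := by
    ext i
    fin_cases i
    · simp [hu0]; linear_combination -h0
    · simp [hu1]; linear_combination h1
    · simp [hu2, hv2, hγ]
  rw [this]
  exact W.add_mem (W.add_mem (W.smul_mem _ hu) (W.smul_mem _ hv)) (W.smul_mem _ hw)

lemma map_gradMap_Vh (h n N d : ℕ) (hh : 1 ≤ h) (hd : 2 * N + h * n - 1 ≤ d)
    (p : Fin N → Fin 3 → ℂ) (hp : ∀ j, (p j 0, p j 1) ≠ (0, 0))
    (hdist : ∀ j j', j ≠ j' → p j 0 * p j' 1 ≠ p j' 0 * p j 1) :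
    (Vh h d n).map (gradMap p) = ⊤ := by
  suffices H : ∀ j, ((Vh h d n).map (gradMap p)).comap
      (LinearMap.single ℂ (fun _ : Fin N => Fin 3 → ℂ) j) = ⊤ by
    rw [eq_top_iff]
    rintro t -
    rw [← Finset.univ_sum_single t]
    refine Submodule.sum_mem _ fun j _ => ?_
    have : t j ∈ (⊤ : Submodule ℂ (Fin 3 → ℂ)) := trivial
    rwa [← H j] at this
  intro j
  have hN : 1 ≤ N := by have := j.isLt; lia
  have hnh : n ≤ h * n := Nat.le_mul_of_pos_left n hh
  obtain ⟨Q, hQw, hQd, hQe, hQs⟩ := exists_separating_form n N p hdist j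
  have key : ∀ A : MvPolynomial (Fin 3) ℂ, Q * A ∈ Vh h d n →
      (fun i => eval (p j) (pderiv i (Q * A))) ∈ ((Vh h d n).map (gradMap p)).comap
        (LinearMap.single ℂ (fun _ : Fin N => Fin 3 → ℂ) j) := by
    intro A hA
    refine ⟨Q * A, hA, ?_⟩
    ext k i
    by_cases hk : k = j
    · subst hk; simp
    · rw [gradMap_apply, singularAt_of_sq_dvd (by simp [mul_comm]) ((hQs k hk).mul_right A)]
      simp [Pi.single_eq_of_ne hk]
  obtain ⟨i, hi2, hiw, hie⟩ : ∃ i : Fin 3, (2 : Fin 3) ≠ i ∧ wt n i = 1 ∧ p j i ≠ 0 := by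
    by_cases hx : p j 0 = 0
    · exact ⟨1, by decide, rfl, fun hy => hp j (by rw [hx, hy])⟩
    · exact ⟨0, by decide, rfl, hx⟩
  have hXw : ∀ e, (X i ^ e : MvPolynomial (Fin 3) ℂ).IsWeightedHomogeneous (wt n) e := by
    intro e
    simpa [hiw] using (isWeightedHomogeneous_X ℂ (wt n) i).pow e
  have hXd : ∀ e, (X i ^ e : MvPolynomial (Fin 3) ℂ).degreeOf 2 = 0 :=
    fun e => degreeOf_X_pow_of_ne e hi2
  have hX2 : ∀ e, (pderiv 2) (X i ^ e : MvPolynomial (Fin 3) ℂ) = 0 :=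
    fun e => pderiv_eq_zero_of_degreeOf_eq_zero (hXd e)
  have hQ2 : pderiv 2 Q = 0 := pderiv_eq_zero_of_degreeOf_eq_zero hQd
  have hmem : ∀ A : MvPolynomial (Fin 3) ℂ,
      A.IsWeightedHomogeneous (wt n) (d - 2 * (N - 1)) → A.degreeOf 2 ≤ 1 →
      Q * A ∈ Vh h d n := by
    intro A hA hA2
    refine ⟨?_, ?_⟩
    · have := hQw.mul hA
      rwa [show 2 * (N - 1) + (d - 2 * (N - 1)) = d by lia] at this
    · have := degreeOf_mul_le 2 Q A
      exact this.trans (by lia)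
  have hU := hmem (X i ^ (d + 1 - 2 * N) * fiberEq (p j))
    (by simpa [show d + 1 - 2 * N + 1 = d - 2 * (N - 1) by lia] using
        (hXw (d + 1 - 2 * N)).mul (isWeightedHomogeneous_fiberEq n (p j)))
    ((degreeOf_mul_le _ _ _).trans (by simp [hXd, degreeOf_two_fiberEq]))
  have hV := hmem (X i ^ (d - 2 * (N - 1))) (hXw _) (by simp [hXd])
  have hW := hmem (X i ^ (d - 2 * (N - 1) - n) * X 2)
    (by
      have := (hXw (d - 2 * (N - 1) - n)).mul (isWeightedHomogeneous_X ℂ (wt n) 2)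
      rwa [show d - 2 * (N - 1) - n + wt n 2 = d - 2 * (N - 1) by
        change _ + n = _; lia] at this)
    ((degreeOf_mul_le _ _ _).trans (by simp [hXd]))
  refine eq_top_of_three_vectors (hp j) (key _ hU) (key _ hV) (key _ hW)
    (c := eval (p j) Q * p j i ^ (d + 1 - 2 * N)) (mul_ne_zero hQe (pow_ne_zero _ hie))
    ?_ ?_ ?_ ?_ ?_ ?_
  · simp [fiberEq, mul_comm (p j 0) (p j 1), pderiv_X]
    ring
  · simp [fiberEq, mul_comm (p j 0) (p j 1), pderiv_X]
    ring
  · simp [hQ2, hX2, pderiv_eq_zero_of_degreeOf_eq_zero (degreeOf_two_fiberEq (p j))]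
  · have hE := congrArg (eval (p j)) (hV.1 : IsWeightedHomogeneous _ _ _).sum_weight_X_mul_pderiv
    rw [Fin.sum_univ_three, Derivation.leibniz (pderiv 2), hX2, hQ2] at hE
    simp only [wt, Matrix.cons_val_zero, Matrix.cons_val_one, one_smul, smul_zero, add_zero,
      mul_zero, map_add, map_mul, eval_X, map_pow, nsmul_eq_mul] at hE
    rw [hE]
    simp only [map_natCast]
    refine mul_ne_zero (Nat.cast_ne_zero.mpr ?_) (mul_ne_zero hQe (pow_ne_zero _ hie))
    lia
  · simp [hQ2, hX2]
  · simp [hQ2, hX2, hQe, hie]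

/-- Remark 2.6: for `h ≥ 3`, `n ≥ 1`, `N ≥ 1`, `d ≥ 2N + hn - 1`, and `N` points of `𝔽ₙ` off
the exceptional section lying on pairwise distinct lines of the ruling, the subspace of
`V^{(h)}_{d,n} = H⁰(𝔽ₙ, O(hEₙ + dFₙ))` of sections singular at all `N` points has dimension
`(h+1)(d+1) - n·h(h+1)/2 - 3N`. -/
theorem finrank_singular_subspace_general (h n N d : ℕ) (hh : 3 ≤ h) (hn : 1 ≤ n) (hN : 1 ≤ N)
    (hd : 2 * N + h * n - 1 ≤ d)
    (p : Fin N → Fin 3 → ℂ)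
    (hp : ∀ j, (p j 0, p j 1) ≠ (0, 0))
    (hdist : ∀ j j', j ≠ j' → p j 0 * p j' 1 ≠ p j' 0 * p j 1) :
    Module.finrank ℂ ↥(Vh h d n ⊓ singSub p)
      = (h + 1) * (d + 1) - n * (h * (h + 1) / 2) - 3 * N := by

  have hNd : n * h ≤ d := by rw [mul_comm]; lia
  have := finiteDimensional_Vh h d n hNd
  have hrn := LinearMap.finrank_range_add_finrank_ker ((gradMap p).domRestrict (Vh h d n))
  have hrange : LinearMap.range ((gradMap p).domRestrict (Vh h d n)) = ⊤ := by
    rw [LinearMap.range_domRestrict, map_gradMap_Vh h n N d (by lia) hd p hp hdist]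
  have hker : Module.finrank ℂ (LinearMap.ker ((gradMap p).domRestrict (Vh h d n))) =
      Module.finrank ℂ ↥(Vh h d n ⊓ singSub p) := by
    rw [LinearMap.ker_domRestrict, ker_gradMap, ← Submodule.map_comap_subtype,
      Submodule.finrank_map_subtype_eq]
  rw [hrange, hker, finrank_top, Module.finrank_pi_fintype] at hrn
  have hV := finrank_Vh h d n hNd
  simp at hrn
  lia

end
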